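/- Let G be a group and σ : Fin k → G a family with Subgroup.closure (Set.range σ) = ⊤. Suppose G is virtually free, i.e. there is a subgroup H ≤ G of finite index (H.index ≠ 0) such that H is a free group (IsFreeGroup H). Then the recurring domino problem RDP(G,σ) is ComputablePred. -/

import Mathlib

/-- An instance of the domino problems on a group with a generating family
indexed by `Fin k`. -/
abbrev DomInstance (k : ℕ) : Type := Σ m : ℕ, Finset (Fin m × Fin m × Fin k) × Fin m

instance (k : ℕ) : Infinite (DomInstance k) :=
  Infinite.of_injective (fun n => (⟨n + 1, ∅, 0⟩ : DomInstance k)) fun a b h => by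
    have : a + 1 = b + 1 := congrArg Sigma.fst h
    omega

noncomputable instance (k : ℕ) : Denumerable (DomInstance k) :=
  Denumerable.ofEncodableOfInfinite _

/-- The recurring domino problem on `G` with respect to the generating family `σ`. -/
def RDP (G : Type*) [Group G] {k : ℕ} (σ : Fin k → G) (I : DomInstance k) : Prop :=
  ∃ x : G → Fin I.1,
    (∀ (g : G) (i : Fin k), (x g, x (g * σ i), i) ∉ I.2.1) ∧
    {g : G | x g = I.2.2}.Infinite

open Encodable

attribute [fun_prop] Primrec Primrec.id Primrec.const

section

variable {α β γ : Type*} [Primcodable α] [Primcodable β] [Primcodable γ]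

@[fun_prop]
theorem Primrec.comp' {f : β → γ} {g : α → β} (hf : Primrec f) (hg : Primrec g) :
    Primrec fun x => f (g x) := hf.comp hg

@[fun_prop]
theorem Primrec.fst' {f : α → β × γ} (hf : Primrec f) : Primrec fun x => (f x).1 :=
  Primrec.fst.comp hf

@[fun_prop]
theorem Primrec.snd' {f : α → β × γ} (hf : Primrec f) : Primrec fun x => (f x).2 :=
  Primrec.snd.comp hf

@[fun_prop]
theorem Primrec.pair' {f : α → β} {g : α → γ} (hf : Primrec f) (hg : Primrec g) :
    Primrec fun x => (f x, g x) := hf.pair hg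

end

theorem PrimrecPred.exists_mem {α β : Type*} [Primcodable α] [Primcodable β] {f : α → List β}
    {p : α → β → Prop} (hf : Primrec f) (hp : PrimrecPred fun x : α × β => p x.1 x.2) :
    PrimrecPred fun a => ∃ b ∈ f a, p a b :=
  (PrimrecRel.exists_mem_list (R := fun b a => p a b)
    (hp.comp (Primrec.snd.pair Primrec.fst))).comp hf Primrec.id

theorem PrimrecPred.forall_mem {α β : Type*} [Primcodable α] [Primcodable β] {f : α → List β}
    {p : α → β → Prop} (hf : Primrec f) (hp : PrimrecPred fun x : α × β => p x.1 x.2) :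
    PrimrecPred fun a => ∀ b ∈ f a, p a b :=
  (PrimrecRel.forall_mem_list (R := fun b a => p a b)
    (hp.comp (Primrec.snd.pair Primrec.fst))).comp hf Primrec.id

theorem PrimrecPred.imp {α : Type*} [Primcodable α] {p q : α → Prop}
    (hp : PrimrecPred p) (hq : PrimrecPred q) : PrimrecPred fun a => p a → q a :=
  (hp.not.or hq).of_eq fun _ => by tauto

theorem encode_ofEncodableOfInfinite {α : Type*} [Encodable α] [Infinite α]
    [DecidablePred (· ∈ Set.range (encode : α → ℕ))] (a : α) :
    @encode α (Denumerable.ofEncodableOfInfinite α).toEncodable a =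
      ((List.range (encode a)).filter (· ∈ Set.range (encode : α → ℕ))).length := by
  have h : @encode α (Denumerable.ofEncodableOfInfinite α).toEncodable a =
      (List.range (encode a)).countP
        fun n => @decide _ (decidableRangeEncode α n) := rfl
  rw [h, List.countP_eq_length_filter]
  congr! 2
  ext n
  congr!

theorem computable_of_encode_eq_length_filter {α β : Type*} [Primcodable α] [Primcodable β]
    (e : α → ℕ) (g : α → β) (hg : ∀ a, encode (g a) = e a)
    [DecidablePred (· ∈ Set.range e)] (hr : PrimrecPred (· ∈ Set.range e))
    (he : ∀ a, encode a = ((List.range (e a)).filter (· ∈ Set.range e)).length) :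
    Computable g := by
  let rank : ℕ → ℕ := fun c => ((List.range c).filter (· ∈ Set.range e)).length
  have hrank : Primrec rank :=
    Primrec.list_length.comp ((Primrec.listFilter hr).comp Primrec.list_range)
  have hP : PrimrecPred fun x : α × ℕ => x.2 ∈ Set.range e ∧ rank x.2 = encode x.1 :=
    (hr.comp Primrec.snd).and
      (Primrec.eq.comp (hrank.comp Primrec.snd) (Primrec.encode.comp Primrec.fst))
  let P : α → ℕ →. Bool := fun a c => Part.some (decide (c ∈ Set.range e ∧ rank c = encode a))
  have hfind : Partrec fun a : α => Nat.rfind (P a) :=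
    Partrec.rfind (Primrec.to_comp hP.decide).partrec
  have hmem : ∀ a : α, e a ∈ Nat.rfind (P a) := by
    intro a
    rw [Nat.mem_rfind]
    refine ⟨?_, fun {c} hc => ?_⟩
    · simpa [P] using (he a).symm
    · simp only [P, Part.mem_some_iff, Bool.false_eq, decide_eq_false_iff_not, not_and]
      rintro ⟨b, rfl⟩ hb
      exact hc.ne (congrArg e (encode_injective ((he b).trans hb)))
  have hecomp : Computable e := hfind.of_eq fun a => Part.eq_some_iff.2 (hmem a)
  refine Computable.option_some_iff.1 ((Computable.decode.comp hecomp).of_eq fun a => ?_)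
  simp [← hg]

theorem computable_of_encode_eq {α β : Type*} [Encodable α] [Infinite α] [Primcodable β]
    (g : α → β) (hg : ∀ a, encode (g a) = encode a)
    (hr : PrimrecPred fun n : ℕ => n ∈ Set.range (encode : α → ℕ)) :
    @Computable α β (@Primcodable.ofDenumerable α (Denumerable.ofEncodableOfInfinite α)) _ g := by
  classical
  exact @computable_of_encode_eq_length_filter α β
    (@Primcodable.ofDenumerable α (Denumerable.ofEncodableOfInfinite α)) _ encode g hg _ hr
    encode_ofEncodableOfInfinite

/-- The natural number data of a pattern. -/
def rawTriple {m k : ℕ} (t : Fin m × Fin m × Fin k) : ℕ × ℕ × ℕ := (t.1, t.2.1, t.2.2)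

/-- The natural number data of a domino problem instance. -/
def DomInstance.raw {k : ℕ} (I : DomInstance k) : ℕ × List (ℕ × ℕ × ℕ) × ℕ :=
  (I.1, (I.2.1.1.sort (encode' _ ⁻¹'o (· ≤ ·))).map rawTriple, I.2.2)

theorem encode_rawTriple {m k : ℕ} (t : Fin m × Fin m × Fin k) :
    encode (rawTriple t) = encode t := by
  rfl

theorem encode_list_map {α β : Type*} [Encodable α] [Encodable β] (f : α → β)
    (hf : ∀ a, encode (f a) = encode a) (l : List α) : encode (l.map f) = encode l := by
  induction l with
  | nil => rfl
  | cons a l ih => simp [hf, ih]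

theorem DomInstance.encode_raw {k : ℕ} (I : DomInstance k) : encode I.raw =
    @encode (Σ m : ℕ, Finset (Fin m × Fin m × Fin k) × Fin m) _ I := by
  have h := encode_list_map rawTriple encode_rawTriple
    (I.2.1.1.sort (encode' (Fin I.1 × Fin I.1 × Fin k) ⁻¹'o (· ≤ ·)))
  change Nat.pair _ (Nat.pair _ _) = Nat.pair _ (Nat.pair _ _)
  congr 2

theorem DomInstance.mem_range_raw {k : ℕ} (x : ℕ × List (ℕ × ℕ × ℕ) × ℕ) :
    x ∈ Set.range (DomInstance.raw (k := k)) ↔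
      (∀ t ∈ x.2.1, t.1 < x.1 ∧ t.2.1 < x.1 ∧ t.2.2 < k) ∧ x.2.2 < x.1 ∧
        x.2.1.Pairwise (encode · < encode ·) := by
  obtain ⟨m, l, a⟩ := x
  constructor
  · rintro ⟨⟨m, F, a⟩, h⟩
    simp only [DomInstance.raw, Prod.mk.injEq] at h
    obtain ⟨rfl, rfl, rfl⟩ := h
    refine ⟨?_, a.2, ?_⟩
    · simp only [List.mem_map]
      rintro _ ⟨t, -, rfl⟩
      exact ⟨t.1.2, t.2.1.2, t.2.2.2⟩
    · simp only [List.pairwise_map, encode_rawTriple]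
      have h1 := F.1.pairwise_sort (encode' (Fin m × Fin m × Fin k) ⁻¹'o (· ≤ ·))
      have h2 : (F.1.sort (encode' (Fin m × Fin m × Fin k) ⁻¹'o (· ≤ ·))).Nodup := by
        rw [← Multiset.coe_nodup, Multiset.sort_eq]; exact F.2
      exact (h1.and h2).imp fun {s t} h => lt_of_le_of_ne h.1 fun h' => h.2 (encode_injective h')
  · rintro ⟨hl, ha, hs⟩
    simp only at hl ha hs
    obtain ⟨l', rfl⟩ : ∃ l' : List (Fin m × Fin m × Fin k), l'.map rawTriple = l := by
      refine ⟨l.pmap (fun t h => (⟨t.1, h.1⟩, ⟨t.2.1, h.2.1⟩, ⟨t.2.2, h.2.2⟩)) hl, ?_⟩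
      rw [List.map_pmap]
      simp [rawTriple]
    simp only [List.pairwise_map, encode_rawTriple] at hs
    have hnd : l'.Nodup := hs.imp fun h h' => h.ne (congrArg encode h')
    refine ⟨⟨m, ⟨(l' : Multiset _), Multiset.coe_nodup.2 hnd⟩, ⟨a, ha⟩⟩, ?_⟩
    simp only [DomInstance.raw, Prod.mk.injEq, true_and, and_true]
    congr 1
    rw [Multiset.coe_sort]
    exact List.mergeSort_of_pairwise (hs.imp fun h => decide_eq_true h.le)

theorem primrecPred_pairwise_encode {α : Type*} [Primcodable α] :
    PrimrecPred fun l : List α => l.Pairwise (encode · < encode ·) := by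
  have key : PrimrecPred fun l : List α => ∀ j ∈ List.range l.length, ∀ i ∈ List.range j,
      (encode l[i]? < encode l[j]?) := by
    refine PrimrecPred.forall_mem (Primrec.list_range.comp Primrec.list_length)
      (PrimrecPred.forall_mem (Primrec.list_range.comp Primrec.snd) (Primrec.nat_lt.comp
        (Primrec.encode.comp (Primrec.list_getElem?.comp
          (Primrec.fst.comp Primrec.fst) Primrec.snd))
        (Primrec.encode.comp (Primrec.list_getElem?.comp
          (Primrec.fst.comp Primrec.fst) (Primrec.snd.comp Primrec.fst)))))
  refine key.of_eq fun l => ?_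
  rw [List.pairwise_iff_getElem]
  constructor
  · intro h i j hi hj hij
    simpa [hi, hj] using! h j (by simpa using hj) i (by simpa using hij)
  · intro h j hj i hi
    simp only [List.mem_range] at hi hj
    simpa [hj, hi.trans hj] using! h i j (hi.trans hj) hj hi

theorem DomInstance.computable_raw {k : ℕ} : Computable (DomInstance.raw (k := k)) := by
  refine computable_of_encode_eq _ DomInstance.encode_raw ?_
  have hv : PrimrecPred fun x : ℕ × List (ℕ × ℕ × ℕ) × ℕ =>
      x ∈ Set.range (DomInstance.raw (k := k)) := by
    simp only [DomInstance.mem_range_raw]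
    refine .and (.forall_mem (Primrec.fst.comp Primrec.snd) (.and ?_ (.and ?_ ?_)))
      (.and ?_ ?_)
    · exact Primrec.nat_lt.comp (Primrec.fst.comp Primrec.snd) (Primrec.fst.comp Primrec.fst)
    · exact Primrec.nat_lt.comp (Primrec.fst.comp (Primrec.snd.comp Primrec.snd))
        (Primrec.fst.comp Primrec.fst)
    · exact Primrec.nat_lt.comp (Primrec.snd.comp (Primrec.snd.comp Primrec.snd))
        (Primrec.const k)
    · exact Primrec.nat_lt.comp (Primrec.snd.comp Primrec.snd) Primrec.fst
    · exact primrecPred_pairwise_encode.comp (Primrec.fst.comp Primrec.snd)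
  have key : PrimrecPred fun n : ℕ =>
      n ∈ Set.range (encode : ℕ × List (ℕ × ℕ × ℕ) × ℕ → ℕ) ∧
      ∃ x ∈ (decode n : Option (ℕ × List (ℕ × ℕ × ℕ) × ℕ)).toList,
        x ∈ Set.range (DomInstance.raw (k := k)) :=
    (Primcodable.mem_range_encode).and (.exists_mem (Primrec.optionToList.comp Primrec.decode)
      (hv.comp Primrec.snd))
  refine key.of_eq fun n => ?_
  constructor
  · rintro ⟨⟨y, rfl⟩, x, hx, I, rfl⟩
    simp only [encodek, Option.toList_some, List.mem_singleton] at hx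
    exact ⟨I, by rw [← hx, DomInstance.encode_raw]⟩
  · rintro ⟨I, rfl⟩
    rw [← DomInstance.encode_raw]
    exact ⟨⟨_, rfl⟩, I.raw, by rw [encodek]; exact List.mem_singleton_self _, I, rfl⟩

theorem computablePred_of_raw {k : ℕ} {P : DomInstance k → Prop}
    {Q : ℕ × List (ℕ × ℕ × ℕ) × ℕ → Prop} (hQ : PrimrecPred Q) (h : ∀ I, P I ↔ Q I.raw) :
    ComputablePred P := by
  classical
  refine ⟨inferInstance, ((Primrec.to_comp hQ.decide).comp DomInstance.computable_raw).of_eq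
    fun I => ?_⟩
  simp [h]

section
variable {α β γ : Type*} [Primcodable α] [Primcodable β] [Primcodable γ]

theorem PrimrecPred.mem {f : α → β} {l : α → List β} (hf : Primrec f) (hl : Primrec l) :
    PrimrecPred fun a => f a ∈ l a := by
  refine (PrimrecPred.exists_mem (p := fun a b => b = f a) hl
    (Primrec.eq.comp (by fun_prop) (by fun_prop))).of_eq fun a => ?_
  simp

theorem Primrec.list_sublists' : Primrec (List.sublists' : List β → List (List β)) := by
  have h : Primrec fun l : List β =>
      l.foldr (fun a acc => acc ++ acc.map (List.cons a)) [[]] := by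
    refine Primrec.list_foldr
      (h := fun (_ : List β) (x : β × List (List β)) => x.2 ++ x.2.map (List.cons x.1))
      Primrec.id (Primrec.const _) ?_
    change Primrec fun y : List β × β × List (List β) => y.2.2 ++ y.2.2.map (List.cons y.2.1)
    refine Primrec.list_append.comp (by fun_prop) (Primrec.list_map (by fun_prop) ?_)
    exact Primrec.list_cons.comp (by fun_prop) (by fun_prop)
  refine h.of_eq fun l => ?_
  induction l with
  | nil => rfl
  | cons a l ih => simp [ih]

/-- The lists of length `d` with entries below `m`. -/
def boundedLists (m : ℕ) : ℕ → List (List ℕ)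
  | 0 => [[]]
  | d + 1 => (List.range m).flatMap fun a => (boundedLists m d).map (List.cons a)

theorem mem_boundedLists {m d : ℕ} {l : List ℕ} :
    l ∈ boundedLists m d ↔ l.length = d ∧ ∀ a ∈ l, a < m := by
  induction d generalizing l with
  | zero => simp +contextual [boundedLists]
  | succ d ih =>
    cases l with
    | nil => simp [boundedLists]
    | cons a l => simp [boundedLists, ih]; tauto

theorem primrec_boundedLists (d : ℕ) : Primrec fun m => boundedLists m d := by
  induction d with
  | zero => exact Primrec.const _
  | succ d ih =>
    refine Primrec.list_flatMap Primrec.list_range (Primrec.list_map (by fun_prop) ?_)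
    exact Primrec.list_cons.comp (by fun_prop) (by fun_prop)

/-- `b` lies in every subset of `Q` that contains `a` and is closed under `R`. -/
def ReachIn (Q : List β) (R : β → β → Prop) (a b : β) : Prop :=
  ∀ Z ∈ Q.sublists', a ∈ Z → (∀ u ∈ Z, ∀ v ∈ Q, R u v → v ∈ Z) → b ∈ Z

theorem PrimrecPred.reachIn {Q : γ → List β} {R : γ → β → β → Prop} {a b : γ → β}
    (hQ : Primrec Q) (hR : PrimrecPred fun x : γ × β × β => R x.1 x.2.1 x.2.2)
    (ha : Primrec a) (hb : Primrec b) :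
    PrimrecPred fun c => ReachIn (Q c) (R c) (a c) (b c) := by
  refine .forall_mem (Primrec.list_sublists'.comp hQ) (.imp (.mem (by fun_prop) (by fun_prop))
    (.imp (.forall_mem (by fun_prop) (.forall_mem (by fun_prop) (.imp ?_ ?_))) ?_))
  · exact hR.comp (f := fun x : ((γ × List β) × β) × β => (x.1.1.1, x.1.2, x.2)) (by fun_prop)
  · exact .mem (by fun_prop) (by fun_prop)
  · exact .mem (by fun_prop) (by fun_prop)

/-- One step of a reduced walk: the states record the current letter and the last direction. -/
def WalkStep {A ι : Type*} (E : ι × Bool → A → A → Prop) (p q : A × ι × Bool) : Prop :=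
  E q.2 p.1 q.1 ∧ (p.2.1 = q.2.1 → p.2.2 = q.2.2)

/-- The finite criterion for the existence of a configuration on a free group, with letters
in `X`, admissible along `E` and hitting `B` infinitely often. -/
def RecurrentAlphabet {A ι : Type*} (S : List (ι × Bool)) (E : ι × Bool → A → A → Prop)
    (V B : A → Prop) (X : List A) : Prop :=
  (∀ a ∈ X, V a ∧ ∀ s ∈ S, ∃ b ∈ X, E s a b) ∧
  ∃ p ∈ X.product S, ∃ q ∈ X.product S, WalkStep E p q ∧
    ReachIn (X.product S) (WalkStep E) q p ∧
    (B p.1 ∨ ∃ u ∈ X.product S, ∃ v ∈ X.product S,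
      WalkStep E p u ∧ u.2 ≠ q.2 ∧ ReachIn (X.product S) (WalkStep E) u v ∧ B v.1)

theorem Primrec.list_product (S : List β) : Primrec fun l : List α => l.product S :=
  Primrec.list_flatMap Primrec.id
    (Primrec.list_map (Primrec.const _) (Primrec.pair (by fun_prop) (by fun_prop)))

theorem PrimrecPred.walkStep {A ι : Type*} [Primcodable A] [Primcodable ι]
    {E : γ → ι × Bool → A → A → Prop}
    (hE : PrimrecPred fun x : γ × (ι × Bool) × A × A => E x.1 x.2.1 x.2.2.1 x.2.2.2)
    {f : α → γ} {p q : α → A × ι × Bool} (hf : Primrec f) (hp : Primrec p) (hq : Primrec q) :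
    PrimrecPred fun d => WalkStep (E (f d)) (p d) (q d) := by
  refine .and ?_ (.imp (Primrec.eq.comp (by fun_prop) (by fun_prop))
    (Primrec.eq.comp (by fun_prop) (by fun_prop)))
  exact hE.comp (f := fun d => (f d, (q d).2, (p d).1, (q d).1)) (by fun_prop)

theorem PrimrecPred.reachIn_walkStep {A ι : Type*} [Primcodable A] [Primcodable ι]
    (S : List (ι × Bool)) {E : γ → ι × Bool → A → A → Prop}
    (hE : PrimrecPred fun x : γ × (ι × Bool) × A × A => E x.1 x.2.1 x.2.2.1 x.2.2.2)
    {f : α → γ} {X : α → List A} {p q : α → A × ι × Bool} (hf : Primrec f) (hX : Primrec X)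
    (hp : Primrec p) (hq : Primrec q) :
    PrimrecPred fun d => ReachIn ((X d).product S) (WalkStep (E (f d))) (p d) (q d) :=
  .reachIn ((Primrec.list_product S).comp hX)
    (.walkStep hE (by fun_prop) (by fun_prop) (by fun_prop)) hp hq

theorem PrimrecPred.recurrentAlphabet {A ι : Type*} [Primcodable A] [Primcodable ι]
    (S : List (ι × Bool)) {E : γ → ι × Bool → A → A → Prop} {V B : γ → A → Prop}
    {X : γ → List A}
    (hE : PrimrecPred fun x : γ × (ι × Bool) × A × A => E x.1 x.2.1 x.2.2.1 x.2.2.2)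
    (hV : PrimrecPred fun x : γ × A => V x.1 x.2) (hB : PrimrecPred fun x : γ × A => B x.1 x.2)
    (hX : Primrec X) :
    PrimrecPred fun c => RecurrentAlphabet S (E c) (V c) (B c) (X c) := by
  have hQ : Primrec fun c => (X c).product S := (Primrec.list_product S).comp hX
  refine .and (.forall_mem hX (.and hV (.forall_mem (by fun_prop) (.exists_mem (by fun_prop) ?_))))
    (.exists_mem hQ (.exists_mem (hQ.comp Primrec.fst) (.and ?_ (.and ?_ (.or ?_
      (.exists_mem (hQ.comp (Primrec.fst.comp Primrec.fst))
        (.exists_mem (hQ.comp (by fun_prop)) (.and ?_ (.and ?_ (.and ?_ ?_))))))))))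
  · exact hE.comp (f := fun x : ((γ × A) × ι × Bool) × A => (x.1.1.1, x.1.2, x.1.1.2, x.2))
      (by fun_prop)
  · exact .walkStep hE (by fun_prop) (by fun_prop) (by fun_prop)
  · exact .reachIn_walkStep S hE (by fun_prop) (by fun_prop) (by fun_prop) (by fun_prop)
  · exact hB.comp (f := fun x : (γ × (A × ι × Bool)) × (A × ι × Bool) => (x.1.1, x.1.2.1))
      (by fun_prop)
  · exact .walkStep hE (by fun_prop) (by fun_prop) (by fun_prop)
  · exact .not (Primrec.eq.comp (by fun_prop) (by fun_prop))
  · exact .reachIn_walkStep S hE (by fun_prop) (by fun_prop) (by fun_prop) (by fun_prop)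
  · exact hB.comp (f := fun x : (((γ × (A × ι × Bool)) × (A × ι × Bool)) × (A × ι × Bool)) ×
      (A × ι × Bool) => (x.1.1.1.1, x.2.1)) (by fun_prop)
end

/-- The coordinate constraints between the letters at the two ends of an edge. -/
def LetterAdj {ι : Type*} (L : List ((ι × Bool) × ℕ × ℕ)) (s : ι × Bool) (a b : List ℕ) : Prop :=
  ∀ c ∈ L, c.1 = s → a[c.2.1]? = b[c.2.2]?

/-- No coordinate pair of `C` carries a pattern of `F`. -/
def LetterValid (C F : List (ℕ × ℕ × ℕ)) (a : List ℕ) : Prop :=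
  ∀ c ∈ C, ∀ t ∈ F, ¬(a[c.1]? = some t.1 ∧ a[c.2.1]? = some t.2.1 ∧ c.2.2 = t.2.2)

/-- One of the coordinates in `T` carries `a₀`. -/
def LetterMarked (T : List ℕ) (a₀ : ℕ) (a : List ℕ) : Prop := ∃ c ∈ T, a[c]? = some a₀

theorem primrecPred_recurrentLetters {ι : Type*} [Primcodable ι] (S : List (ι × Bool)) (d : ℕ)
    (L : List ((ι × Bool) × ℕ × ℕ)) (C : List (ℕ × ℕ × ℕ)) (T : List ℕ) :
    PrimrecPred fun I : ℕ × List (ℕ × ℕ × ℕ) × ℕ => ∃ X ∈ (boundedLists I.1 d).sublists',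
      RecurrentAlphabet S (LetterAdj L) (LetterValid C I.2.1) (LetterMarked T I.2.2) X := by
  refine .exists_mem (Primrec.list_sublists'.comp ((primrec_boundedLists d).comp Primrec.fst))
    (.recurrentAlphabet S ?_ ?_ ?_ Primrec.snd)
  · refine .forall_mem (by fun_prop) (.imp (Primrec.eq.comp (by fun_prop) (by fun_prop))
      (Primrec.eq.comp (Primrec.list_getElem?.comp ?_ ?_) (Primrec.list_getElem?.comp ?_ ?_))) <;>
      fun_prop
  · refine .forall_mem (by fun_prop) (.forall_mem (by fun_prop) (.not (.and
      (Primrec.eq.comp (Primrec.list_getElem?.comp ?_ ?_) (Primrec.option_some.comp ?_))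
      (.and (Primrec.eq.comp (Primrec.list_getElem?.comp ?_ ?_) (Primrec.option_some.comp ?_))
        (Primrec.eq.comp ?_ ?_))))) <;> fun_prop
  · refine .exists_mem (by fun_prop) (Primrec.eq.comp (Primrec.list_getElem?.comp ?_ ?_)
      (Primrec.option_some.comp ?_)) <;> fun_prop

theorem reachIn_iff {β : Type*} {Q : List β} {R : β → β → Prop} {a b : β} (ha : a ∈ Q) :
    ReachIn Q R a b ↔ Relation.ReflTransGen (fun u v => R u v ∧ v ∈ Q) a b := by
  classical
  constructor
  · intro h
    have := h (Q.filter fun v => Relation.ReflTransGen (fun u v => R u v ∧ v ∈ Q) a v)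
      (List.mem_sublists'.2 List.filter_sublist)
      (by simp [ha, Relation.ReflTransGen.refl]) fun u hu v hv huv => by
        simp only [List.mem_filter, decide_eq_true_eq] at hu ⊢
        exact ⟨hv, hu.2.tail ⟨huv, hv⟩⟩
    simp only [List.mem_filter, decide_eq_true_eq] at this
    exact this.2
  · intro h Z _ haZ hZ
    induction h with
    | refl => exact haZ
    | tail _ h ih => exact hZ _ ih _ h.2 h.1

/-- The automaton states: the current letter, the letters and directions of the walk that is
being followed, and whether this walk is the cycle. -/
abbrev CombState (A ι : Type*) : Type _ := A × List (A × ι × Bool) × Bool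

/-- The last letter of the walk `t` starting from the letter `a`. -/
def walkEnd {A ι : Type*} (a : A) (t : List (A × ι × Bool)) : A := t.foldl (fun _ x => x.1) a

/-- The walk `t` starting from the letter `a` is admissible and stays in `X`. -/
def WalkIn {A ι : Type*} (E : ι × Bool → A → A → Prop) (X : List A) : A → List (A × ι × Bool) → Prop
  | a, [] => a ∈ X
  | a, x :: t => a ∈ X ∧ E x.2 a x.1 ∧ WalkIn E X x.1 t

theorem WalkIn.mem {A ι : Type*}
    {E : ι × Bool → A → A → Prop} {X : List A} {a : A} {t : List (A × ι × Bool)}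
    (h : WalkIn E X a t) : a ∈ X := by
  cases t with
  | nil => exact h
  | cons x t => exact h.1

theorem walkIn_of_isChain {A ι : Type*}
    {E : ι × Bool → A → A → Prop} {X : List A} {x : A × ι × Bool}
    {t : List (A × ι × Bool)} (hx : x.1 ∈ X)
    (h : (x :: t).IsChain fun u v => WalkStep E u v ∧ v.1 ∈ X) : WalkIn E X x.1 t := by
  induction t generalizing x with
  | nil => exact hx
  | cons z t ih =>
    rw [List.isChain_cons_cons] at h
    exact ⟨hx, h.1.1.1, ih h.1.2 h.2⟩

theorem walkEnd_eq_getLast {A ι : Type*} (x : A × ι × Bool) (t : List (A × ι × Bool)) :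
    walkEnd x.1 t = ((x :: t).getLast (List.cons_ne_nil _ _)).1 := by
  induction t generalizing x with
  | nil => rfl
  | cons z t ih => exact (ih z).trans (by simp)

section Comb

variable {A ι : Type*} [DecidableEq ι] (next : A → ι × Bool → A)
  (q : A × ι × Bool) (l b : List (A × ι × Bool))

/-- Follow the walk `t` in direction `s`, or leave it for good. -/
def followWalk (a : A) (t : List (A × ι × Bool)) (c : Bool) (s : ι × Bool) : CombState A ι :=
  match t with
  | [] => (next a s, [], false)
  | x :: t => if s = x.2 then (x.1, t, c) else (next a s, [], false)

/-- The automaton reading the cycle `q :: l` any number of times, and then the branch `b`. -/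
def combStep (x : CombState A ι) (s : ι × Bool) : CombState A ι :=
  match x with
  | (a, [], true) => if s = q.2 then (q.1, l, true) else followWalk next a b false s
  | (a, t, c) => followWalk next a t c s

/-- The invariant of the states of the automaton `combStep`. -/
def CombInv (E : ι × Bool → A → A → Prop) (X : List A) (a₀ : A) (x : CombState A ι) : Prop :=
  WalkIn E X x.1 x.2.1 ∧ (x.2.2 = true → walkEnd x.1 x.2.1 = a₀)

variable {next q l b}

theorem followWalk_spec {E : ι × Bool → A → A → Prop} {X : List A} {a₀ : A}
    (hnext : ∀ a ∈ X, ∀ s, next a s ∈ X ∧ E s a (next a s)) {a : A} {t : List (A × ι × Bool)}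
    {c : Bool} (h : CombInv E X a₀ (a, t, c)) (s : ι × Bool) :
    CombInv E X a₀ (followWalk next a t c s) ∧ E s a (followWalk next a t c s).1 := by
  have hf : CombInv E X a₀ (next a s, [], false) ∧ E s a (next a s) :=
    ⟨⟨(hnext a h.1.mem s).1, by simp⟩, (hnext a h.1.mem s).2⟩
  cases t with
  | nil => exact hf
  | cons x t =>
    simp only [followWalk]
    split_ifs with hs
    · subst hs
      exact ⟨⟨h.1.2.2, h.2⟩, h.1.2.1⟩
    · exact hf

theorem combStep_spec {E : ι × Bool → A → A → Prop} {X : List A} {a₀ : A}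
    (hnext : ∀ a ∈ X, ∀ s, next a s ∈ X ∧ E s a (next a s))
    (hl : WalkIn E X a₀ (q :: l)) (hle : walkEnd q.1 l = a₀) (hb : WalkIn E X a₀ b)
    {x : CombState A ι} (h : CombInv E X a₀ x) (s : ι × Bool) :
    CombInv E X a₀ (combStep next q l b x s) ∧ E s x.1 (combStep next q l b x s).1 := by
  obtain ⟨a, t, c⟩ := x
  match t, c with
  | [], true =>
    obtain rfl : a = a₀ := h.2 rfl
    simp only [combStep]
    split_ifs with hs
    · subst hs
      exact ⟨⟨hl.2.2, fun _ => hle⟩, hl.2.1⟩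
    · exact followWalk_spec hnext ⟨hb, by simp⟩ s
  | [], false => exact followWalk_spec hnext h s
  | y :: t, c => exact followWalk_spec hnext h s

theorem foldl_combStep_walk (a : A) (t : List (A × ι × Bool)) (c : Bool) :
    (t.map Prod.snd).foldl (combStep next q l b) (a, t, c) = (walkEnd a t, [], c) := by
  induction t generalizing a with
  | nil => rfl
  | cons x t ih =>
    simp only [List.map_cons, List.foldl_cons, combStep, followWalk, if_true]
    exact ih x.1

theorem foldl_combStep_cycle {a : A} (hle : walkEnd q.1 l = a) (n : ℕ) :
    ((List.replicate n (q :: l)).flatten.map Prod.snd).foldl (combStep next q l b)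
      (a, [], true) = (a, [], true) := by
  induction n with
  | zero => rfl
  | succ n ih =>
    rw [List.replicate_succ, List.flatten_cons, List.map_append, List.foldl_append,
      List.map_cons, List.foldl_cons]
    simp only [combStep, if_true]
    rw [foldl_combStep_walk, hle, ih]

theorem foldl_combStep_branch (a : A) (hb : ∀ u ∈ b.head?, u.2 ≠ q.2) :
    ((b.map Prod.snd).foldl (combStep next q l b) (a, [], true)).1 = walkEnd a b := by
  cases b with
  | nil => rfl
  | cons u t =>
    have hu : u.2 ≠ q.2 := hb u rfl
    simp only [List.map_cons, List.foldl_cons, combStep, followWalk, if_neg hu, if_true]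
    rw [foldl_combStep_walk]
    rfl

end Comb

/-- A subword of a reduced word is reduced. -/
theorem FreeGroup.IsReduced.of_append_eq {ι : Type*} {w u : List (ι × Bool)}
    (h : FreeGroup.IsReduced w) (u₁ u₂ : List (ι × Bool)) (hw : u₁ ++ u ++ u₂ = w) :
    FreeGroup.IsReduced u := by
  subst hw
  exact (List.isChain_append.1 (List.isChain_append.1 h).1).2.1

/-- An edge of the Cayley graph of a free group either prolongs or shortens the reduced word. -/
theorem FreeGroup.toWord_mul_mk_singleton {ι : Type*} [DecidableEq ι] (h : FreeGroup ι)
    (s : ι × Bool) : (h * FreeGroup.mk [s]).toWord = h.toWord ++ [s] ∨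
      h.toWord = (h * FreeGroup.mk [s]).toWord ++ [(s.1, !s.2)] := by
  have key : ∀ (g : FreeGroup ι) (t : ι × Bool), FreeGroup.IsReduced (g.toWord ++ [t]) →
      (g * FreeGroup.mk [t]).toWord = g.toWord ++ [t] := by
    intro g t ht
    conv_lhs => rw [← FreeGroup.mk_toWord (x := g), FreeGroup.mul_mk, FreeGroup.toWord_mk]
    exact ht.reduce_eq
  rcases List.eq_nil_or_concat h.toWord with hw | ⟨w, t, hw⟩
  · exact .inl (key h s (by simp [hw]))
  · rw [List.concat_eq_append] at hw
    by_cases hts : t = (s.1, !s.2)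
    · right
      have hg : h * FreeGroup.mk [s] = FreeGroup.mk w := by
        rw [← FreeGroup.mk_toWord (x := h), hw, hts, FreeGroup.mul_mk, List.append_assoc]
        refine FreeGroup.Red.exact.2 ⟨w, ?_, .refl⟩
        have := FreeGroup.Red.Step.not_rev (L₁ := w) (L₂ := []) (x := s.1) (b := s.2)
        simpa using this.to_red
      have hr : FreeGroup.IsReduced w :=
        (FreeGroup.isReduced_toWord (x := h)).of_append_eq [] [t] (by simp [hw])
      rw [hg, FreeGroup.toWord_mk, hr.reduce_eq, hw, hts]
    · left
      refine key h s ?_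
      have hr := FreeGroup.isReduced_toWord (x := h)
      rw [hw] at hr ⊢
      refine hr.append_overlap ?_ (by simp)
      simp only [List.singleton_append, FreeGroup.isReduced_cons_cons,
        FreeGroup.IsReduced.singleton, and_true]
      intro h1
      by_contra h2
      exact hts (Prod.ext h1 (by cases h : t.2 <;> cases h' : s.2 <;> simp_all))

theorem exists_config_of_recurrentAlphabet {A ι : Type*} [DecidableEq ι] {S : List (ι × Bool)}
    (hS : ∀ s, s ∈ S) {E : ι × Bool → A → A → Prop}
    (hE : ∀ s a b, E s a b → E (s.1, !s.2) b a) {V B : A → Prop} {X : List A}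
    (h : RecurrentAlphabet S E V B X) :
    ∃ y : FreeGroup ι → A, (∀ g, y g ∈ X) ∧ (∀ g, V (y g)) ∧
      (∀ g s, E s (y g) (y (g * FreeGroup.mk [s]))) ∧ {g | B (y g)}.Infinite := by
  classical
  obtain ⟨hX, p, hp, q, hq, hpq, hqp, hB⟩ := h
  have hprod : ∀ x : A × ι × Bool, x ∈ X.product S ↔ x.1 ∈ X := fun x => by
    exact List.mem_product.trans (and_iff_left (hS _))
  have hpath : ∀ u v : A × ι × Bool, u ∈ X.product S → ReachIn (X.product S) (WalkStep E) u v →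
      ∃ t, (u :: t).IsChain (fun x z => WalkStep E x z ∧ z.1 ∈ X) ∧
        (u :: t).getLast (List.cons_ne_nil _ _) = v := by
    intro u v hu h
    rw [reachIn_iff hu] at h
    simp only [hprod] at h
    exact List.exists_isChain_cons_of_relationReflTransGen h
  have hnext : ∀ a : A, ∃ f : ι × Bool → A, a ∈ X → ∀ s, f s ∈ X ∧ E s a (f s) := by
    intro a
    by_cases ha : a ∈ X
    · choose f hf using fun s => (hX a ha).2 s (hS s)
      exact ⟨f, fun _ => hf⟩
    · exact ⟨fun _ => a, fun h => absurd h ha⟩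
  choose next hnext using hnext
  obtain ⟨l, hl, hle⟩ := hpath q p hq hqp
  obtain ⟨b, hb, hbB, hbq⟩ : ∃ b, (p :: b).IsChain (fun x z => WalkStep E x z ∧ z.1 ∈ X) ∧
      B (walkEnd p.1 b) ∧ ∀ u ∈ b.head?, u.2 ≠ q.2 := by
    rcases hB with hB | ⟨u, hu, v, hv, hpu, huq, huv, hB⟩
    · exact ⟨[], by simp, hB, by simp⟩
    · obtain ⟨t, ht, hte⟩ := hpath u v hu huv
      refine ⟨u :: t, List.isChain_cons_cons.2 ⟨⟨hpu, (hprod u).1 hu⟩, ht⟩, ?_, by simpa using huq⟩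
      change B (walkEnd u.1 t)
      rwa [walkEnd_eq_getLast, hte]
  have hpX := (hprod p).1 hp
  have hqX := (hprod q).1 hq
  have hle' : walkEnd q.1 l = p.1 := by rw [walkEnd_eq_getLast, hle]
  have spec : ∀ {x}, CombInv E X p.1 x → ∀ s, _ := fun {x} hx s =>
    combStep_spec (next := next) (q := q) (l := l) (b := b) hnext
      ⟨hpX, hpq.1, walkIn_of_isChain hqX hl⟩ hle' (walkIn_of_isChain hpX hb) (x := x) hx s
  let run : List (ι × Bool) → CombState A ι := List.foldl (combStep next q l b) (p.1, [], true)
  have hinv : ∀ w, CombInv E X p.1 (run w) := by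
    intro w
    induction w using List.reverseRecOn with
    | nil => exact ⟨hpX, fun _ => rfl⟩
    | append_singleton w s ih =>
      simp only [run, List.foldl_append, List.foldl_cons, List.foldl_nil]
      exact (spec ih s).1
  have hadj : ∀ w s, E s (run w).1 (run (w ++ [s])).1 := by
    intro w s
    simp only [run, List.foldl_append, List.foldl_cons, List.foldl_nil]
    exact (spec (hinv w) s).2
  refine ⟨fun g => (run g.toWord).1, fun g => (hinv _).1.mem, fun g => (hX _ (hinv _).1.mem).1,
    fun g s => ?_, ?_⟩
  · rcases FreeGroup.toWord_mul_mk_singleton g s with h | h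
    · simp only [h]
      exact hadj _ _
    · have := hE _ _ _ (hadj (g * FreeGroup.mk [s]).toWord (s.1, !s.2))
      rw [← h] at this
      simpa using this
  · have hlred : FreeGroup.IsReduced ((q :: l).map Prod.snd) :=
      List.isChain_map_of_isChain Prod.snd (fun _ _ h => h.1.2) hl
    have hbred : FreeGroup.IsReduced ((p :: b).map Prod.snd) :=
      List.isChain_map_of_isChain Prod.snd (fun _ _ h => h.1.2) hb
    have hlast : ((q :: l).map Prod.snd).getLast? = some p.2 := by
      rw [List.getLast?_map, List.getLast?_eq_some_getLast (List.cons_ne_nil _ _), hle]; rfl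
    have hcyc : FreeGroup.IsCyclicallyReduced ((q :: l).map Prod.snd) := by
      refine ⟨hlred, ?_⟩
      rw [hlast]
      simpa using hpq.2
    have hcb : FreeGroup.IsReduced ([] ++ (q :: l).map Prod.snd ++ b.map Prod.snd) := by
      rw [List.nil_append]
      refine List.isChain_append.2 ⟨hlred, hbred.tail, ?_⟩
      rw [hlast]
      intro x hx z hz
      obtain rfl : p.2 = x := by simpa using hx
      cases b with
      | nil => simp at hz
      | cons u t =>
        obtain rfl : u.2 = z := by simpa using hz
        exact (List.isChain_cons_cons.1 hb).1.1.2
    let w : ℕ → List (ι × Bool) := fun n =>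
      (List.replicate (n + 1) ((q :: l).map Prod.snd)).flatten ++ b.map Prod.snd
    have hw : ∀ n, FreeGroup.IsReduced (w n) := fun n => by
      simpa [w] using hcb.append_flatten_replicate_append hcyc n.succ_ne_zero
    have hwB : ∀ n, B (run (w n)).1 := by
      intro n
      have h1 := foldl_combStep_cycle (next := next) (b := b) hle' (n + 1)
      rw [List.map_flatten, List.map_replicate] at h1
      simp only [run, w, List.foldl_append]
      rw [h1, foldl_combStep_branch _ hbq]
      exact hbB
    refine Set.infinite_of_injective_forall_mem (f := fun n => FreeGroup.mk (w n)) ?_ fun n => ?_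
    · intro n m hnm
      have h1 := congrArg FreeGroup.toWord hnm
      simp only [FreeGroup.toWord_mk, (hw _).reduce_eq] at h1
      have h2 := congrArg List.length h1
      simpa [w] using h2
    · simp only [Set.mem_ofPred_eq, FreeGroup.toWord_mk, (hw _).reduce_eq]
      exact hwB n

/-- König's lemma for infinite sets of words: some infinite ray only passes through prefixes
of infinitely many words of the set. -/
theorem exists_ray_of_infinite {D : Type*} [Finite D] {W : Set (List D)} (hW : W.Infinite) :
    ∃ (w : ℕ → List D) (c : ℕ → D), (∀ n, w (n + 1) = w n ++ [c n]) ∧ (∀ n, (w n).length = n) ∧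
      ∀ n, {v ∈ W | w n <+: v}.Infinite := by
  have step : ∀ u : {u : List D // {v ∈ W | u <+: v}.Infinite},
      ∃ s : D, {v ∈ W | u.1 ++ [s] <+: v}.Infinite := by
    rintro ⟨u, hu⟩
    by_contra! hfin
    refine hu (((Set.finite_singleton u).union (Set.finite_iUnion hfin)).subset ?_)
    rintro v ⟨hv, t, rfl⟩
    cases t with
    | nil => simp
    | cons s t => exact .inr (Set.mem_iUnion.2 ⟨s, hv, t, by simp⟩)
  choose c hc using step
  let w : ℕ → {u : List D // {v ∈ W | u <+: v}.Infinite} := fun n =>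
    Nat.rec ⟨[], by simpa using hW⟩ (fun _ u => ⟨u.1 ++ [c u], hc u⟩) n
  refine ⟨fun n => (w n).1, fun n => c (w n), fun n => rfl, fun n => ?_, fun n => (w n).2⟩
  induction n with
  | zero => rfl
  | succ n ih => simpa [w] using ih

theorem recurrentAlphabet_of_config {A ι : Type*} [DecidableEq ι] [Finite ι]
    {S : List (ι × Bool)} (hS : ∀ s, s ∈ S) {E : ι × Bool → A → A → Prop} {V B : A → Prop}
    {X : List A} {y : FreeGroup ι → A} (hX : ∀ a, a ∈ X ↔ a ∈ Set.range y) (hV : ∀ g, V (y g))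
    (hE : ∀ g s, E s (y g) (y (g * FreeGroup.mk [s]))) (hB : {g | B (y g)}.Infinite) :
    RecurrentAlphabet S E V B X := by
  classical
  refine ⟨fun a ha => ?_, ?_⟩
  · obtain ⟨g, rfl⟩ := (hX a).1 ha
    exact ⟨hV g, fun s _ => ⟨_, (hX _).2 ⟨_, rfl⟩, hE g s⟩⟩
  let z : List (ι × Bool) → A := fun w => y (FreeGroup.mk w)
  have hzE : ∀ w s, E s (z w) (z (w ++ [s])) := fun w s => by
    simpa [z, FreeGroup.mul_mk] using hE (FreeGroup.mk w) s
  have hQ : ∀ w s, (z w, s) ∈ X.product S := fun w s =>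
    List.mem_product.2 ⟨(hX _).2 ⟨_, rfl⟩, hS s⟩
  have hwalk : ∀ w s t, FreeGroup.IsReduced (w ++ [s] ++ [t]) →
      WalkStep E (z (w ++ [s]), s) (z (w ++ [s] ++ [t]), t) := by
    intro w s t h
    refine ⟨hzE _ _, ?_⟩
    have : FreeGroup.IsReduced [s, t] := h.of_append_eq w [] (by simp)
    simpa using this
  let R : A × ι × Bool → A × ι × Bool → Prop := fun u v => WalkStep E u v ∧ v ∈ X.product S
  have hreach : ∀ (t : List (ι × Bool)) w s, FreeGroup.IsReduced (w ++ [s] ++ t) →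
      ∃ s', Relation.ReflTransGen R (z (w ++ [s]), s) (z (w ++ [s] ++ t), s') := by
    intro t
    induction t with
    | nil => exact fun w s _ => ⟨s, by simp [Relation.ReflTransGen.refl]⟩
    | cons s' t ih =>
      intro w s h
      obtain ⟨s'', hs''⟩ := ih (w ++ [s]) s' (by simpa using h)
      refine ⟨s'', ?_⟩
      rw [List.append_cons (w ++ [s])]
      exact .head ⟨hwalk w s s' (h.of_append_eq [] t (by simp)), hQ _ _⟩ hs''
  have hWinf : {v : List (ι × Bool) | FreeGroup.IsReduced v ∧ B (z v)}.Infinite := by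
    refine (hB.image (FreeGroup.toWord_injective (α := ι)).injOn).mono ?_
    rintro _ ⟨g, hg, rfl⟩
    exact ⟨FreeGroup.isReduced_toWord, by simpa [z, FreeGroup.mk_toWord] using hg⟩
  obtain ⟨w, c, hw, hlen, hinf⟩ := exists_ray_of_infinite hWinf
  have hred : ∀ n, FreeGroup.IsReduced (w n) := fun n => by
    obtain ⟨v, hv, t, rfl⟩ := (hinf n).nonempty
    exact hv.1.of_append_eq [] t (by simp)
  have hpre : ∀ {m n}, m ≤ n → w m <+: w n := by
    intro m n h
    induction h with
    | refl => exact List.prefix_rfl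
    | step _ ih => exact ih.trans ⟨[c _], (hw _).symm⟩
  let st : ℕ → A × ι × Bool := fun n => (z (w (n + 1)), c n)
  have hst : ∀ n, st n ∈ X.product S := fun n => hQ _ _
  have hstep : ∀ n, WalkStep E (st n) (st (n + 1)) := by
    intro n
    have h := hwalk (w n) (c n) (c (n + 1)) (by simpa [hw] using hred (n + 1 + 1))
    simpa [st, hw] using h
  have hstreach : ∀ {m n}, m ≤ n → Relation.ReflTransGen R (st m) (st n) := by
    intro m n h
    induction h with
    | refl => exact .refl
    | step _ ih => exact ih.tail ⟨hstep _, hst _⟩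
  obtain ⟨p₀, hp₀⟩ : ∃ p₀, {n | st n = p₀}.Infinite := by
    by_contra! hfin
    have h1 : {x : A × ι × Bool | x ∈ X.product S}.Finite := List.finite_toSet _
    exact Set.infinite_univ ((h1.biUnion fun p _ => hfin p).subset fun n _ =>
      Set.mem_iUnion₂.2 ⟨st n, hst n, rfl⟩)
  obtain ⟨n₀, hn₀⟩ := hp₀.nonempty
  obtain ⟨v, ⟨hvr, hvB⟩, hv⟩ := (hinf (n₀ + 1)).nonempty
  obtain ⟨n₁, hn₁, hlt⟩ := hp₀.exists_gt (max n₀ v.length)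
  obtain ⟨j, hj, hjv, hjn⟩ : ∃ j, n₀ ≤ j ∧ w (j + 1) <+: v ∧ ¬ w (j + 1 + 1) <+: v := by
    by_contra! h
    have : ∀ n, n₀ ≤ n → w (n + 1) <+: v := fun n hn => by
      induction hn with
      | refl => exact hv
      | step hn ih => exact h _ hn ih
    have := (this n₁ (by omega)).length_le
    rw [hlen] at this
    omega
  have hjn₁ : j + 1 ≤ n₁ := by
    have := hjv.length_le
    rw [hlen] at this
    omega
  refine ⟨st j, hst _, st (j + 1), hst _, hstep j, (reachIn_iff (hst _)).2 ?_, ?_⟩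
  · have h1 := hstreach hjn₁
    rw [show st n₁ = st n₀ from Eq.trans hn₁ (Eq.symm hn₀)] at h1
    exact h1.trans (hstreach hj)
  · obtain ⟨t, rfl⟩ := hjv
    cases t with
    | nil => exact .inl (by simpa [st] using hvB)
    | cons s t =>
      have hs : s ≠ c (j + 1) := by
        rintro rfl
        exact hjn ⟨t, by simp [hw]⟩
      obtain ⟨s', hs'⟩ := hreach t (w (j + 1)) s (by simpa using hvr)
      refine .inr ⟨_, hQ (w (j + 1) ++ [s]) s, _, hQ _ s', ?_, hs,
        (reachIn_iff (hQ _ _)).2 hs', by simpa using hvB⟩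
      have h := hwalk (w j) (c j) s (by
        rw [← hw]; exact hvr.of_append_eq [] t (by simp))
      rwa [← hw] at h

theorem exists_config_iff_exists_recurrentAlphabet {A ι : Type*} [DecidableEq ι] [Finite ι]
    {S : List (ι × Bool)} (hS : ∀ s, s ∈ S) {E : ι × Bool → A → A → Prop}
    (hE : ∀ s a b, E s a b → E (s.1, !s.2) b a) {V B : A → Prop} {Y : List A} :
    (∃ y : FreeGroup ι → A, (∀ g, y g ∈ Y) ∧ (∀ g, V (y g)) ∧
      (∀ g s, E s (y g) (y (g * FreeGroup.mk [s]))) ∧ {g | B (y g)}.Infinite) ↔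
    ∃ X ∈ Y.sublists', RecurrentAlphabet S E V B X := by
  classical
  constructor
  · rintro ⟨y, hY, hV, hy, hB⟩
    refine ⟨Y.filter (· ∈ Set.range y), List.mem_sublists'.2 List.filter_sublist,
      recurrentAlphabet_of_config hS (fun a => ?_) hV hy hB⟩
    simp only [List.mem_filter, decide_eq_true_eq, and_iff_right_iff_imp]
    rintro ⟨g, rfl⟩
    exact hY g
  · rintro ⟨X, hX, h⟩
    obtain ⟨y, hy, h⟩ := exists_config_of_recurrentAlphabet hS hE h
    exact ⟨y, fun g => (List.mem_sublists'.1 hX).subset (hy g), h⟩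

/-- A finitely generated free group is free on finitely many generators. -/
theorem exists_mulEquiv_freeGroup_fin (H : Type*) [Group H] [IsFreeGroup H] [Group.FG H] :
    ∃ r : ℕ, Nonempty (H ≃* FreeGroup (Fin r)) := by
  obtain ⟨S, hS, hfin⟩ := (Group.fg_iff (G := H)).1 inferInstance
  have : Finite S := hfin
  have hinj : Function.Injective
      (fun (f : IsFreeGroup.Generators H → Multiplicative (ZMod 2)) (s : S) =>
        IsFreeGroup.lift f s) := by
    intro f g hfg
    refine IsFreeGroup.lift.injective (MonoidHom.eq_of_eqOn_dense hS fun s hs => ?_)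
    exact congrFun hfg ⟨s, hs⟩
  have : Finite (IsFreeGroup.Generators H) := by
    have h1 := Finite.of_injective _ hinj
    by_contra h2
    rw [not_finite_iff_infinite] at h2
    have : Nontrivial (Multiplicative (ZMod 2)) := inferInstanceAs (Nontrivial (ZMod 2))
    have : Infinite (IsFreeGroup.Generators H → Multiplicative (ZMod 2)) := inferInstance
    exact not_finite (IsFreeGroup.Generators H → Multiplicative (ZMod 2))
  exact ⟨_, ⟨(IsFreeGroup.toFreeGroup H).trans
    (FreeGroup.freeGroupCongr (Finite.equivFin (IsFreeGroup.Generators H)))⟩⟩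

/-- Coordinates on a virtually free group: a free group times a finite transversal, together
with the action of the generators in these coordinates. -/
theorem exists_equiv_freeGroup_prod {G : Type*} [Group G] {k : ℕ}
    (σ : Fin k → G) (hσ : Subgroup.closure (Set.range σ) = ⊤)
    (H : Subgroup G) (hind : H.index ≠ 0) (hfree : IsFreeGroup H) :
    ∃ (r n : ℕ) (ψ : FreeGroup (Fin r) × Fin n ≃ G) (η : Fin n → Fin k → FreeGroup (Fin r))
      (τ : Fin n → Fin k → Fin n),
      ∀ h j i, ψ (h, j) * σ i = ψ (h * η j i, τ j i) := by
  have hG : Group.FG G := Group.fg_iff.2 ⟨_, hσ, Set.finite_range σ⟩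
  have : H.FiniteIndex := ⟨hind⟩
  have hH : Group.FG H := inferInstance
  obtain ⟨r, ⟨f⟩⟩ := exists_mulEquiv_freeGroup_fin H
  obtain ⟨T, hT, -⟩ := H.exists_isComplement_right 1
  have hTf : Finite T := hT.finite_right_iff.2 inferInstance
  let e := Finite.equivFin T
  let ψ : FreeGroup (Fin r) × Fin (Nat.card T) ≃ G :=
    (f.symm.toEquiv.prodCongr e.symm).trans (Equiv.ofBijective _ hT)
  have hψ : ∀ h j, ψ (h, j) = f.symm h * (e.symm j : T) := fun h j => rfl
  refine ⟨r, _, ψ, fun j i => (ψ.symm (ψ (1, j) * σ i)).1,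
    fun j i => (ψ.symm (ψ (1, j) * σ i)).2, fun h j i => ?_⟩
  have h1 : ψ (ψ.symm (ψ (1, j) * σ i)) = ψ (1, j) * σ i := ψ.apply_symm_apply _
  rw [← Prod.mk.eta (p := ψ.symm (ψ (1, j) * σ i)), hψ] at h1
  rw [hψ, hψ, map_mul, Subgroup.coe_mul, mul_assoc, mul_assoc]
  refine congrArg _ (Eq.trans ?_ h1.symm)
  rw [hψ, map_one, Subgroup.coe_one, one_mul]

/-- The index set of the patches: words of length at most `R` and elements of a transversal. -/
abbrev PatchIndex (r n R : ℕ) : Type := {w : List (Fin r × Bool) // w.length ≤ R} × Fin n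

instance (r n R : ℕ) : Finite (PatchIndex r n R) :=
  have : Finite {w : List (Fin r × Bool) // w.length ≤ R} := List.finite_length_le _ _
  inferInstance

/-- The indices `a` and `b` denote the same place, seen from both ends of an edge labelled `s`. -/
def PatchOverlap {r n R : ℕ} (s : Fin r × Bool) (a b : PatchIndex r n R) : Prop :=
  a.2 = b.2 ∧ (a.1.1 = s :: b.1.1 ∨ b.1.1 = (s.1, !s.2) :: a.1.1)

theorem PatchOverlap.symm {r n R : ℕ} {s : Fin r × Bool} {a b : PatchIndex r n R}
    (h : PatchOverlap s a b) : PatchOverlap (s.1, !s.2) b a :=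
  ⟨h.1.symm, by simpa using h.2.symm⟩

/-- The index of the transversal element `j`. -/
def patchBase {r n : ℕ} (R : ℕ) (j : Fin n) : PatchIndex r n R := (⟨[], Nat.zero_le R⟩, j)

/-- Configurations correspond to overlapping families of patches on the free group. -/
theorem exists_config_iff_exists_patches {r n k m R : ℕ}
    (η : Fin n → Fin k → FreeGroup (Fin r)) (τ : Fin n → Fin k → Fin n)
    (hR : ∀ j i, (η j i).toWord.length ≤ R) (F : Finset (Fin m × Fin m × Fin k)) (a₀ : Fin m) :
    (∃ x : FreeGroup (Fin r) × Fin n → Fin m,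
      (∀ h j i, (x (h, j), x (h * η j i, τ j i), i) ∉ F) ∧ {p | x p = a₀}.Infinite) ↔
    ∃ y : FreeGroup (Fin r) → PatchIndex r n R → Fin m,
      (∀ g j i, (y g (patchBase R j), y g (⟨(η j i).toWord, hR j i⟩, τ j i), i) ∉ F) ∧
      (∀ g s a b, PatchOverlap s a b → y g a = y (g * FreeGroup.mk [s]) b) ∧
      {g | ∃ j, y g (patchBase R j) = a₀}.Infinite := by
  constructor
  · rintro ⟨x, hx, hinf⟩
    have hone : FreeGroup.mk ([] : List (Fin r × Bool)) = 1 := rfl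
    refine ⟨fun g a => x (g * FreeGroup.mk a.1.1, a.2), fun g j i => ?_, ?_, ?_⟩
    · simpa [patchBase, hone, FreeGroup.mk_toWord] using hx g j i
    · rintro g s ⟨⟨w, hw⟩, j⟩ ⟨⟨w', hw'⟩, j'⟩ ⟨hj, h⟩
      obtain rfl : j = j' := hj
      replace h : w = s :: w' ∨ w' = (s.1, !s.2) :: w := h
      have hinv : FreeGroup.mk [s] * FreeGroup.mk [(s.1, !s.2)] = 1 := by
        rw [FreeGroup.mul_mk, ← hone]
        exact FreeGroup.Red.exact.2 ⟨[], FreeGroup.Red.Step.to_red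
          (FreeGroup.Red.Step.not (L₁ := []) (L₂ := []) (x := s.1) (b := s.2)), .refl⟩
      rcases h with rfl | rfl
      · simp only [mul_assoc, FreeGroup.mul_mk, List.singleton_append]
      · have : FreeGroup.mk ((s.1, !s.2) :: w) = FreeGroup.mk [(s.1, !s.2)] * FreeGroup.mk w := by
          simp [FreeGroup.mul_mk]
        simp only [this]
        rw [← mul_assoc, mul_assoc g, hinv, mul_one]
    · have h1 : (Prod.fst '' {p | x p = a₀}).Infinite := by
        intro hfin
        exact hinf ((hfin.prod (Set.finite_univ (α := Fin n))).subset
          fun p hp => ⟨⟨p, hp, rfl⟩, trivial⟩)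
      refine h1.mono ?_
      rintro _ ⟨⟨g, j⟩, hp, rfl⟩
      exact ⟨j, by simpa [patchBase, hone] using hp⟩
  · rintro ⟨y, hF, hy, hinf⟩
    have key : ∀ (w : List (Fin r × Bool)) (hw : w.length ≤ R) g j,
        y g (⟨w, hw⟩, j) = y (g * FreeGroup.mk w) (patchBase R j) := by
      intro w
      induction w with
      | nil => exact fun _ g j => by rw [show FreeGroup.mk [] = 1 from rfl, mul_one]; rfl
      | cons s w ih =>
        intro hw g j
        have hw' : w.length ≤ R := (Nat.le_succ _).trans hw
        rw [hy g s (⟨s :: w, hw⟩, j) (⟨w, hw'⟩, j) ⟨rfl, .inl rfl⟩, ih hw', mul_assoc,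
          FreeGroup.mul_mk]
        rfl
    refine ⟨fun p => y p.1 (patchBase R p.2), fun g j i => ?_, ?_⟩
    · have := hF g j i
      rwa [key (η j i).toWord, FreeGroup.mk_toWord] at this
    · have h1 : (Prod.fst '' {p : FreeGroup (Fin r) × Fin n |
          y p.1 (patchBase R p.2) = a₀}).Infinite := by
        refine hinf.mono ?_
        rintro g ⟨j, hj⟩
        exact ⟨(g, j), hj, rfl⟩
      exact h1.of_image _

/-- The letter that lists the values of `f`. -/
def toLetter {N : Type*} {d m : ℕ} (e : N ≃ Fin d) (f : N → Fin m) : List ℕ :=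
  List.ofFn fun i => (f (e.symm i) : ℕ)

theorem toLetter_getElem? {N : Type*} {d m : ℕ} (e : N ≃ Fin d) (f : N → Fin m) (a : N) :
    (toLetter e f)[(e a : ℕ)]? = some (f a : ℕ) := by
  simp [toLetter]

theorem mem_boundedLists_iff_exists_toLetter {N : Type*} {d m : ℕ} (e : N ≃ Fin d) {l : List ℕ} :
    l ∈ boundedLists m d ↔ ∃ f : N → Fin m, toLetter e f = l := by
  rw [mem_boundedLists]
  constructor
  · rintro ⟨rfl, hl⟩
    refine ⟨fun a => ⟨l[(e a : ℕ)], hl _ (List.getElem_mem _)⟩, ?_⟩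
    simp [toLetter]
  · rintro ⟨f, rfl⟩
    simp [toLetter, List.mem_ofFn]

theorem rdp_iff_exists_letters {G : Type*} [Group G] {k : ℕ} (σ : Fin k → G) {r n : ℕ}
    (ψ : FreeGroup (Fin r) × Fin n ≃ G) (η : Fin n → Fin k → FreeGroup (Fin r))
    (τ : Fin n → Fin k → Fin n) (hψ : ∀ h j i, ψ (h, j) * σ i = ψ (h * η j i, τ j i)) :
    ∃ (d : ℕ) (L : List ((Fin r × Bool) × ℕ × ℕ)) (C : List (ℕ × ℕ × ℕ)) (T : List ℕ),
      (∀ s a b, LetterAdj L s a b → LetterAdj L (s.1, !s.2) b a) ∧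
      ∀ I : DomInstance k, RDP G σ I ↔
        ∃ y : FreeGroup (Fin r) → List ℕ, (∀ g, y g ∈ boundedLists I.raw.1 d) ∧
          (∀ g, LetterValid C I.raw.2.1 (y g)) ∧
          (∀ g s, LetterAdj L s (y g) (y (g * FreeGroup.mk [s]))) ∧
          {g | LetterMarked T I.raw.2.2 (y g)}.Infinite := by
  classical
  obtain ⟨R, hR⟩ : ∃ R, ∀ j i, (η j i).toWord.length ≤ R := by
    obtain ⟨R, hR⟩ := (Set.finite_range fun p : Fin n × Fin k =>
      (η p.1 p.2).toWord.length).bddAbove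
    exact ⟨R, fun j i => hR ⟨(j, i), rfl⟩⟩
  have := Fintype.ofFinite (PatchIndex r n R)
  let e := Finite.equivFin (PatchIndex r n R)
  let L : List ((Fin r × Bool) × ℕ × ℕ) :=
    ((Finset.univ.filter fun c : (Fin r × Bool) × PatchIndex r n R × PatchIndex r n R =>
      PatchOverlap c.1 c.2.1 c.2.2).toList.map fun c => (c.1, (e c.2.1 : ℕ), (e c.2.2 : ℕ)))
  let C : List (ℕ × ℕ × ℕ) := (Finset.univ : Finset (Fin n × Fin k)).toList.map fun p =>
    ((e (patchBase R p.1) : ℕ), (e (⟨(η p.1 p.2).toWord, hR p.1 p.2⟩, τ p.1 p.2) : ℕ), (p.2 : ℕ))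
  let T : List ℕ := (Finset.univ : Finset (Fin n)).toList.map fun j => (e (patchBase R j) : ℕ)
  have hL : ∀ s a b, LetterAdj L s a b ↔
      ∀ u v : PatchIndex r n R, PatchOverlap s u v → a[(e u : ℕ)]? = b[(e v : ℕ)]? := by
    intro s a b
    simp only [LetterAdj, L, List.mem_map, Finset.mem_toList, Finset.mem_filter,
      Finset.mem_univ, true_and]
    constructor
    · exact fun h u v huv => h _ ⟨(s, u, v), huv, rfl⟩ rfl
    · rintro h _ ⟨⟨s, u, v⟩, huv, rfl⟩ rfl
      exact h u v huv
  refine ⟨Nat.card (PatchIndex r n R), L, C, T, fun s a b h => ?_, fun I => ?_⟩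
  · rw [hL] at h ⊢
    intro u v huv
    exact (h v u (by simpa using huv.symm)).symm
  have hC : ∀ f : PatchIndex r n R → Fin I.1, LetterValid C I.raw.2.1 (toLetter e f) ↔
      ∀ j i, (f (patchBase R j), f (⟨(η j i).toWord, hR j i⟩, τ j i), i) ∉ I.2.1 := by
    intro f
    have hraw : ∀ t, t ∈ I.raw.2.1 ↔ ∃ t' ∈ I.2.1, rawTriple t' = t := by
      intro t
      simp [DomInstance.raw]
    simp only [LetterValid, C, List.mem_map, Finset.mem_toList, Finset.mem_univ, true_and, hraw]
    constructor
    · intro h j i hF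
      exact h _ ⟨(j, i), rfl⟩ _ ⟨_, hF, rfl⟩
        ⟨toLetter_getElem? .., toLetter_getElem? .., rfl⟩
    · rintro h _ ⟨⟨j, i⟩, rfl⟩ _ ⟨⟨p, q, i'⟩, ht, rfl⟩ ⟨h1, h2, h3⟩
      rw [toLetter_getElem?] at h1 h2
      obtain rfl : f (patchBase R j) = p := Fin.ext (Option.some_injective _ h1)
      obtain rfl : f (⟨(η j i).toWord, hR j i⟩, τ j i) = q := Fin.ext (Option.some_injective _ h2)
      obtain rfl : i = i' := Fin.ext h3
      exact h j i ht
  have hT : ∀ f : PatchIndex r n R → Fin I.1, LetterMarked T I.raw.2.2 (toLetter e f) ↔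
      ∃ j, f (patchBase R j) = I.2.2 := by
    intro f
    simp only [LetterMarked, T, List.mem_map, Finset.mem_toList, Finset.mem_univ, true_and,
      exists_exists_eq_and, toLetter_getElem?, Option.some_inj]
    exact exists_congr fun j => Fin.ext_iff.symm
  have hA : ∀ s (f f' : PatchIndex r n R → Fin I.1),
      LetterAdj L s (toLetter e f) (toLetter e f') ↔
        ∀ u v : PatchIndex r n R, PatchOverlap s u v → f u = f' v := by
    intro s f f'
    simp only [hL, toLetter_getElem?, Option.some_inj, Fin.ext_iff]
  have hx : RDP G σ I ↔ ∃ x : FreeGroup (Fin r) × Fin n → Fin I.1,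
      (∀ h j i, (x (h, j), x (h * η j i, τ j i), i) ∉ I.2.1) ∧ {p | x p = I.2.2}.Infinite := by
    constructor
    · rintro ⟨x, hx, hinf⟩
      refine ⟨x ∘ ψ, fun h j i => ?_, ?_⟩
      · simpa [hψ] using hx (ψ (h, j)) i
      · exact hinf.preimage (by simp [ψ.surjective.range_eq])
    · rintro ⟨x, hx, hinf⟩
      refine ⟨x ∘ ψ.symm, fun g i => ?_, ?_⟩
      · obtain ⟨⟨h, j⟩, rfl⟩ := ψ.surjective g
        simpa [hψ] using hx h j i
      · exact hinf.preimage (by simp [ψ.symm.surjective.range_eq])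
  rw [hx, exists_config_iff_exists_patches η τ hR]
  constructor
  · rintro ⟨y, hF, hy, hinf⟩
    refine ⟨fun g => toLetter e (y g),
      fun g => (mem_boundedLists_iff_exists_toLetter e).2 ⟨_, rfl⟩,
      fun g => (hC _).2 (hF g), fun g s => (hA _ _ _).2 (hy g s), ?_⟩
    simpa only [hT] using hinf
  · rintro ⟨y, hm, hV, hy, hinf⟩
    choose f hf using fun g => (mem_boundedLists_iff_exists_toLetter (m := I.1) e).1 (hm g)
    obtain rfl : (fun g => toLetter e (f g)) = y := funext hf
    refine ⟨f, fun g => (hC _).1 (hV g), fun g s => (hA _ _ _).1 (hy g s), ?_⟩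
    simpa only [hT] using hinf

/-- The recurring domino problem is decidable on virtually free groups. -/
theorem rdp_computablePred_of_virtually_free {G : Type*} [Group G] {k : ℕ}
    (σ : Fin k → G) (hσ : Subgroup.closure (Set.range σ) = ⊤)
    (H : Subgroup G) (hind : H.index ≠ 0) (hfree : IsFreeGroup H) :
    ComputablePred (RDP G σ) := by
  obtain ⟨r, n, ψ, η, τ, hψ⟩ := exists_equiv_freeGroup_prod σ hσ H hind hfree
  obtain ⟨d, L, C, T, hL, hrdp⟩ := rdp_iff_exists_letters σ ψ η τ hψ
  refine computablePred_of_raw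
    (primrecPred_recurrentLetters (Finset.univ : Finset (Fin r × Bool)).toList d L C T)
    fun I => (hrdp I).trans ?_
  exact exists_config_iff_exists_recurrentAlphabet (by simp) hL
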